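/- arXiv:0707.1490 — 2 statements merged into one kernel-verified Lean document; each statement's English description precedes it below -/
import Mathlib

section
/- Let v : ℝ³ → ℝ³ be a differentiable vector field, φ : ℝ → ℝ³ a differentiable curve, and u = v ∘ φ. Fix s ∈ ℝ and suppose the streamline tangency condition holds at s: for all indices i, m ∈ {1,2,3}, vₘ(φ(s)) · φ̇ᵢ(s) = vᵢ(φ(s)) · φ̇ₘ(s). Then for every i ∈ {1,2,3}, vᵢ(φ(s)) · u̇ᵢ(s) = ((v·∇)v)ᵢ(φ(s)) · φ̇ᵢ(s), where ((v·∇)v)ᵢ = Σₘ vₘ ∂vᵢ/∂xₘ is the i-th component of the convective term. -/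
/-- If `u = v ∘ φ` and the streamline tangency condition
`vₘ(φ(s))·φ̇ᵢ(s) = vᵢ(φ(s))·φ̇ₘ(s)` holds at `s`, then for every `i`,
`vᵢ(φ(s)) · u̇ᵢ(s) = ((v·∇)v)ᵢ(φ(s)) · φ̇ᵢ(s)`, where
`((v·∇)v)ᵢ = Σₘ vₘ ∂vᵢ/∂xₘ` is the convective term. -/
theorem convective_term_along_streamline
    (v : (Fin 3 → ℝ) → Fin 3 → ℝ) (φ : ℝ → Fin 3 → ℝ)
    (hv : Differentiable ℝ v) (hφ : Differentiable ℝ φ)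
    (s : ℝ)
    (htan : ∀ i m : Fin 3,
      v (φ s) m * deriv (fun σ => φ σ i) s = v (φ s) i * deriv (fun σ => φ σ m) s) :
    ∀ i : Fin 3,
      v (φ s) i * deriv (fun σ => v (φ σ) i) s =
        (∑ m : Fin 3, v (φ s) m * fderiv ℝ (fun x => v x i) (φ s) (Pi.single m 1)) *
          deriv (fun σ => φ σ i) s := by
  intro i
  have hvi : DifferentiableAt ℝ (fun x => v x i) (φ s) := differentiableAt_pi.1 (hv (φ s)) i
  have hchain : deriv (fun σ => v (φ σ) i) s = fderiv ℝ (fun x => v x i) (φ s) (deriv φ s) :=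
    (hvi.hasFDerivAt.comp_hasDerivAt s (hφ s).hasDerivAt).deriv
  have hcoord : deriv φ s = fun m => deriv (fun σ => φ σ m) s :=
    deriv_pi fun m => differentiableAt_pi.1 (hφ s) m
  rw [hchain, hcoord, ← ContinuousLinearMap.coe_coe, LinearMap.pi_apply_eq_sum_univ,
    Finset.mul_sum, Finset.sum_mul]
  refine Finset.sum_congr rfl fun m _ => ?_
  have hsingle : (fun j => if m = j then (1 : ℝ) else 0) = Pi.single m 1 := by
    ext j
    simp [Pi.single_apply, eq_comm]
  simp only [hsingle, smul_eq_mul, ContinuousLinearMap.coe_coe]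
  linear_combination (-fderiv ℝ (fun x => v x i) (φ s) (Pi.single m 1)) * htan i m
end

section
/- Let g : ℝ³ → ℝ be twice differentiable at a point x ∈ ℝ³, let u₁, u₂, u₃ : ℝ → ℝ be twice differentiable at g(x), let q : ℝ → ℝ be differentiable at g(x), and let ρ, μ ∈ ℝ. Define the velocity field v : ℝ³ → ℝ³ by vᵢ = uᵢ ∘ g and the pressure p = q ∘ g. Then for each i ∈ {1,2,3}, the i-th component of the steady incompressible Navier–Stokes equation, ρ · Σₘ vₘ(x) · ∂vᵢ/∂xₘ(x) = −∂p/∂xᵢ(x) + μ · Δvᵢ(x), holds at x if and only if the ordinary differential relation ρ · (Σₘ uₘ(g(x)) · ∂g/∂xₘ(x)) · u̇ᵢ(g(x)) = −q̇(g(x)) · ∂g/∂xᵢ(x) + μ · ((∇g(x)·∇g(x)) · üᵢ(g(x)) + Δg(x) · u̇ᵢ(g(x))) holds. -/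
/-- Chain rule for a directional derivative of `f ∘ g` with `f` a function of one real variable. -/
theorem fderiv_comp_real_apply {E : Type*} [NormedAddCommGroup E] [NormedSpace ℝ E]
    {f : ℝ → ℝ} {g : E → ℝ} {x : E} (hf : DifferentiableAt ℝ f (g x))
    (hg : DifferentiableAt ℝ g x) (e : E) :
    fderiv ℝ (fun y => f (g y)) x e = deriv f (g x) * fderiv ℝ g x e := by
  have h : HasFDerivAt (fun y => f (g y)) (deriv f (g x) • fderiv ℝ g x) x :=
    hf.hasDerivAt.comp_hasFDerivAt x hg.hasFDerivAt
  rw [h.fderiv, smul_apply, smul_eq_mul]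

/-- Second directional derivative of `f ∘ g` with `f` a function of one real variable. -/
theorem fderiv_fderiv_comp_real_apply {E : Type*} [NormedAddCommGroup E] [NormedSpace ℝ E]
    {f : ℝ → ℝ} {g : E → ℝ} {x : E} {e : E}
    (hf : ∀ᶠ t in nhds (g x), DifferentiableAt ℝ f t)
    (hf' : DifferentiableAt ℝ (deriv f) (g x))
    (hg : ∀ᶠ y in nhds x, DifferentiableAt ℝ g y)
    (hg' : DifferentiableAt ℝ (fun y => fderiv ℝ g y e) x) :
    fderiv ℝ (fun y => fderiv ℝ (fun z => f (g z)) y e) x e =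
      (fderiv ℝ g x e) ^ 2 * deriv (deriv f) (g x) +
        fderiv ℝ (fun y => fderiv ℝ g y e) x e * deriv f (g x) := by
  have hgx : DifferentiableAt ℝ g x := hg.self_of_nhds
  have heq : (fun y => fderiv ℝ (fun z => f (g z)) y e) =ᶠ[nhds x]
      fun y => deriv f (g y) * fderiv ℝ g y e := by
    filter_upwards [hg, hgx.continuousAt.eventually hf] with y hgy hfy
    exact fderiv_comp_real_apply hfy hgy e
  rw [heq.fderiv_eq, fderiv_fun_mul (DifferentiableAt.fun_comp' x hf' hgx) hg',
    add_apply, smul_apply, smul_apply,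
    fderiv_comp_real_apply hf' hgx, smul_eq_mul, smul_eq_mul]
  ring

/-- Under the streamline ansatz `vᵢ = uᵢ ∘ g`, `p = q ∘ g`, the `i`-th
component of the steady incompressible Navier–Stokes equation
`ρ Σₘ vₘ ∂vᵢ/∂xₘ = −∂p/∂xᵢ + μ Δvᵢ` holds at `x` if and only if the ordinary
differential relation
`ρ (Σₘ uₘ(g x) ∂g/∂xₘ(x)) u̇ᵢ(g x) = −q̇(g x) ∂g/∂xᵢ(x) + μ ((∇g·∇g)(x) üᵢ(g x) + Δg(x) u̇ᵢ(g x))`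
holds. -/
theorem navier_stokes_ode_form
    (g : (Fin 3 → ℝ) → ℝ) (u : Fin 3 → ℝ → ℝ) (q : ℝ → ℝ) (ρ μ : ℝ) (x : Fin 3 → ℝ)
    (hg1 : ∀ᶠ y in nhds x, DifferentiableAt ℝ g y)
    (hg2 : ∀ j : Fin 3, DifferentiableAt ℝ (fun y => fderiv ℝ g y (Pi.single j 1)) x)
    (hu1 : ∀ i : Fin 3, ∀ᶠ t in nhds (g x), DifferentiableAt ℝ (u i) t)
    (hu2 : ∀ i : Fin 3, DifferentiableAt ℝ (deriv (u i)) (g x))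
    (hq : DifferentiableAt ℝ q (g x))
    (v : (Fin 3 → ℝ) → Fin 3 → ℝ) (hv : ∀ y i, v y i = u i (g y))
    (p : (Fin 3 → ℝ) → ℝ) (hp : ∀ y, p y = q (g y))
    (i : Fin 3) :
    (ρ * ∑ m : Fin 3, v x m * fderiv ℝ (fun y => v y i) x (Pi.single m 1) =
        -(fderiv ℝ p x (Pi.single i 1)) +
          μ * ∑ j : Fin 3,
            fderiv ℝ (fun y => fderiv ℝ (fun z => v z i) y (Pi.single j 1)) x (Pi.single j 1))
      ↔
    (ρ * (∑ m : Fin 3, u m (g x) * fderiv ℝ g x (Pi.single m 1)) * deriv (u i) (g x) =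
        -(deriv q (g x) * fderiv ℝ g x (Pi.single i 1)) +
          μ * ((∑ j : Fin 3, (fderiv ℝ g x (Pi.single j 1)) ^ 2) * deriv (deriv (u i)) (g x) +
            (∑ j : Fin 3, fderiv ℝ (fun y => fderiv ℝ g y (Pi.single j 1)) x (Pi.single j 1)) *
              deriv (u i) (g x))) := by
  have hgx : DifferentiableAt ℝ g x := hg1.self_of_nhds
  obtain rfl : v = fun y i => u i (g y) := by
    ext y i
    exact hv y i
  obtain rfl : p = fun y => q (g y) := funext hp
  have hgrad (m : Fin 3) := fderiv_comp_real_apply (hu1 i).self_of_nhds hgx (Pi.single m 1)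
  have hlap (j : Fin 3) := fderiv_fderiv_comp_real_apply (hu1 i) (hu2 i) hg1 (hg2 j)
  simp only [hgrad, hlap, fderiv_comp_real_apply hq hgx, Finset.sum_add_distrib, Finset.sum_mul,
    Finset.mul_sum, mul_assoc, mul_comm (deriv (u i) (g x))]
end
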